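/- (Theorem 3.2, part 2) Let m, α ∈ ℝ and W ∈ C⁴(ℝ) with W''''(t) ≥ w² for all t ∈ ℝ, for some constant w > 0. Assume W''(m) + min_{k ∈ 2πℤ^N, k ≠ 0} (α − |k|²)² ≥ 0 and P_N ≥ (W'''(m))² / (3w²). Then the uniform state m is a global minimizer of 𝓕 over H²_m(𝕋^N), i.e., 𝓕(φ) ≥ 𝓕(m) for every φ ∈ H²_m(𝕋^N). Moreover, if P_N > (W'''(m))² / (3w²) strictly, then m is the unique global minimizer: 𝓕(φ) > 𝓕(m) for every φ ∈ H²_m(𝕋^N) with φ ≠ m. -/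

import Mathlib

open MeasureTheory Filter Real

noncomputable section

abbrev Pt (N : ℕ) := Fin N → ℝ

/-- partial derivative in direction `i` -/
def pd {N : ℕ} (i : Fin N) (f : Pt N → ℝ) (x : Pt N) : ℝ := fderiv ℝ f x (Pi.single i 1)

/-- second partial derivative ∂ᵢ∂ⱼ -/
def pd2 {N : ℕ} (i j : Fin N) (f : Pt N → ℝ) : Pt N → ℝ := pd i (pd j f)

/-- the unit cube [0,1]^N, fundamental domain of the torus 𝕋^N -/
def cube (N : ℕ) : Set (Pt N) := Set.Icc 0 1

/-- Laplacian on the torus -/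
def lap {N : ℕ} (f : Pt N → ℝ) (x : Pt N) : ℝ := ∑ i, pd2 i i f x

/-- |∇f|² -/
def gradSq {N : ℕ} (f : Pt N → ℝ) (x : Pt N) : ℝ := ∑ i, (pd i f x)^2

/-- 1-periodicity in each coordinate: a function on the torus 𝕋^N -/
def ZPeriodic {N : ℕ} (f : Pt N → ℝ) : Prop :=
  ∀ (x : Pt N) (i : Fin N), f (x + Pi.single i 1) = f x

/-- min_{k ∈ 2πℤ^N, k ≠ 0} (α - |k|²)² -/
def freqMinPFC (N : ℕ) (α : ℝ) : ℝ :=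
  sInf {t : ℝ | ∃ k : Fin N → ℤ, k ≠ 0 ∧ t = (α - 4*π^2 * ∑ i, ((k i : ℝ))^2)^2}

/-- admissible test functions in the definition of P_N -/
def AdmissibleP {N : ℕ} (u : Pt N → ℝ) : Prop :=
  ContDiff ℝ 2 u ∧ ZPeriodic u ∧
    (∫ x in cube N, (u x)^3) = 1 ∧ (∫ x in cube N, u x) = 0

/-- the product (∫ (αu+Δu)² + c u²) · (∫ u⁴) -/
def Penergy {N : ℕ} (α c : ℝ) (u : Pt N → ℝ) : ℝ :=
  (∫ x in cube N, ((α * u x + lap u x)^2 + c * (u x)^2)) * (∫ x in cube N, (u x)^4)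

/-- the optimal constant P_N (with c = W''(m)) -/
def PN (N : ℕ) (α c : ℝ) : ℝ :=
  sInf {p : ℝ | ∃ u : Pt N → ℝ, AdmissibleP u ∧ p = Penergy α c u}

/-- membership in H²_m(𝕋^N) -/
def MemH2m {N : ℕ} (m : ℝ) (φ : Pt N → ℝ) : Prop :=
  ContDiff ℝ 2 φ ∧ ZPeriodic φ ∧ (∫ x in cube N, φ x) = m

/-- the PFC functional 𝓕 on the torus -/
def Fen {N : ℕ} (α : ℝ) (W : ℝ → ℝ) (φ : Pt N → ℝ) : ℝ :=
  ∫ x in cube N, ((1/2) * (α * φ x + lap φ x)^2 + W (φ x))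

def cf {N : ℕ} (k : Fin N → ℤ) (i : Fin N) : ℂ := -(2 * (π:ℂ) * Complex.I * (k i : ℂ))

def Lk {N : ℕ} (k : Fin N → ℤ) : Pt N →L[ℝ] ℂ :=
  ∑ i, (cf k i) • (Complex.ofRealCLM.comp (ContinuousLinearMap.proj (R := ℝ) (φ := fun _ : Fin N => ℝ) i))

lemma Lk_apply {N : ℕ} (k : Fin N → ℤ) (x : Pt N) : Lk k x = ∑ i, cf k i * (x i : ℂ) := by
  simp [Lk]

lemma Lk_single {N : ℕ} (k : Fin N → ℤ) (i : Fin N) : Lk k (Pi.single i 1) = cf k i := by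
  rw [Lk_apply, Finset.sum_eq_single i]
  · simp
  · intro j _ hj
    simp [Pi.single_eq_of_ne hj]
  · simp

def ek {N : ℕ} (k : Fin N → ℤ) (x : Pt N) : ℂ := Complex.exp (Lk k x)

lemma ek_contDiff {N : ℕ} (k : Fin N → ℤ) : ContDiff ℝ 1 (ek k) :=
  ((Lk k).contDiff).cexp

lemma ek_cont {N : ℕ} (k : Fin N → ℤ) : Continuous (ek k) := (ek_contDiff k).continuous

lemma ek_fderiv {N : ℕ} (k : Fin N → ℤ) (x : Pt N) (i : Fin N) :
    fderiv ℝ (ek k) x (Pi.single i 1) = cf k i * ek k x := by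
  have h : HasFDerivAt (ek k) (Complex.exp (Lk k x) • Lk k) x := ((Lk k).hasFDerivAt).cexp
  rw [h.fderiv]
  simp [Lk_single, ek, mul_comm]

lemma ek_periodic {N : ℕ} (k : Fin N → ℤ) (x : Pt N) (i : Fin N) :
    ek k (x + Pi.single i 1) = ek k x := by
  unfold ek
  rw [map_add, Lk_single, Complex.exp_add]
  have : cf k i = ((-k i : ℤ) : ℂ) * (2 * π * Complex.I) := by
    simp [cf]; ring
  rw [this, Complex.exp_int_mul_two_pi_mul_I, mul_one]

lemma ek_mFourier {N : ℕ} (k : Fin N → ℤ) (x : Pt N) :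
    UnitAddTorus.mFourier (-k) (fun i => (x i : UnitAddCircle)) = ek k x := by
  simp only [UnitAddTorus.mFourier, ContinuousMap.coe_mk, ek, Lk_apply, Complex.exp_sum]
  refine Finset.prod_congr rfl fun i _ => ?_
  rw [fourier_coe_apply]
  congr 1
  simp [cf]

lemma cube_int {N : ℕ} {E : Type*} [NormedAddCommGroup E] {f : Pt N → E} (hf : Continuous f) :
    IntegrableOn f (cube N) := hf.continuousOn.integrableOn_compact isCompact_Icc

lemma ibp {N : ℕ} (g : Pt N → ℂ) (hg : ContDiff ℝ 1 g)
    (hper : ∀ (x : Pt N) (i : Fin N), g (x + Pi.single i 1) = g x) (i : Fin N) :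
    ∫ x in cube N, fderiv ℝ g x (Pi.single i 1) = 0 := by
  obtain _ | n := N
  · exact i.elim0
  have hc : Continuous (fun x => fderiv ℝ g x (Pi.single i 1)) :=
    (hg.continuous_fderiv (by norm_num)).clm_apply continuous_const
  have key := integral_divergence_of_hasFDerivAt_off_countable' (E := ℂ) (n := n) (a := 0) (b := 1)
    (by intro j; simp) (fun j => if j = i then g else 0)
    (fun j x => if j = i then fderiv ℝ g x else 0) ∅ Set.countable_empty
    (by
      intro j
      split_ifs
      · exact hg.continuous.continuousOn
      · exact continuousOn_const)
    (by
      intro x _ j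
      split_ifs
      · exact (hg.differentiable (by norm_num) x).hasFDerivAt
      · exact hasFDerivAt_const (0:ℂ) x)
    (by
      refine cube_int (N := n+1) ?_
      refine continuous_finsetSum _ fun j _ => ?_
      by_cases h : j = i
      · subst h; simpa using hc
      · simpa [h] using continuous_const)
  have e1 : ∀ x : Pt (n+1), (∑ j, (if j = i then fderiv ℝ g x else 0) (Pi.single j 1))
      = fderiv ℝ g x (Pi.single i 1) := by
    intro x
    rw [Finset.sum_eq_single i]
    · simp
    · intro j _ hj; simp [hj]
    · simp
  simp only [e1] at key
  unfold cube
  rw [key]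
  refine Finset.sum_eq_zero fun j _ => ?_
  rw [sub_eq_zero]
  refine integral_congr_ae (Eventually.of_forall fun x => ?_)
  by_cases h : j = i
  · subst h
    simp only [if_true]
    rw [← hper (Fin.insertNth j ((0 : Pt (n+1)) j) x) j]
    congr 1
    ext l
    refine Fin.succAboveCases j ?_ ?_ l
    · simp
    · intro l; simp [Fin.succAbove_ne]
  · simp [h]

def fc {N : ℕ} (k : Fin N → ℤ) (f : Pt N → ℝ) : ℂ := ∫ x in cube N, ek k x * (f x : ℂ)

lemma fc_pd {N : ℕ} (k : Fin N → ℤ) (v : Pt N → ℝ) (hv : ContDiff ℝ 1 v) (hp : ZPeriodic v)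
    (i : Fin N) : fc k (pd i v) = - cf k i * fc k v := by
  have hvc : ContDiff ℝ 1 (fun x => (v x : ℂ)) := Complex.ofRealCLM.contDiff.comp hv
  have h := ibp (fun x => ek k x * (v x : ℂ)) ((ek_contDiff k).mul hvc)
    (fun x j => by simp only [ek_periodic, hp x j]) i
  have e : ∀ x, fderiv ℝ (fun x => ek k x * (v x : ℂ)) x (Pi.single i 1)
      = ek k x * (pd i v x : ℂ) + cf k i * (ek k x * (v x : ℂ)) := by
    intro x
    have h1 := ((ek_contDiff k).differentiable (by norm_num) x).hasFDerivAt
    have h2 : HasFDerivAt (fun x => (v x : ℂ)) (Complex.ofRealCLM.comp (fderiv ℝ v x)) x :=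
      Complex.ofRealCLM.hasFDerivAt.comp x ((hv.differentiable (by norm_num) x).hasFDerivAt)
    rw [show (fun x => ek k x * (v x : ℂ)) = ek k * fun x => (v x : ℂ) from rfl, (h1.mul h2).fderiv]
    simp [ek_fderiv, pd]
    ring
  simp only [e] at h
  have hpc : Continuous (pd i v) :=
    (hv.continuous_fderiv (by norm_num)).clm_apply continuous_const
  rw [integral_add, integral_const_mul] at h
  · unfold fc
    linear_combination h
  · exact cube_int ((ek_cont k).mul (Complex.continuous_ofReal.comp hpc))
  · exact cube_int (continuous_const.mul ((ek_cont k).mul (Complex.continuous_ofReal.comp hv.continuous)))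

lemma pd_contDiff {N : ℕ} (u : Pt N → ℝ) (hu : ContDiff ℝ 2 u) (i : Fin N) :
    ContDiff ℝ 1 (pd i u) :=
  (hu.fderiv_right (m := 1) (by norm_num)).clm_apply contDiff_const

lemma pd_periodic {N : ℕ} (u : Pt N → ℝ) (hu : ZPeriodic u) (i : Fin N) :
    ZPeriodic (pd i u) := by
  intro x j
  unfold pd
  rw [← fderiv_comp_add_right]
  congr 2
  ext y
  exact hu y j

lemma pd2_cont {N : ℕ} (u : Pt N → ℝ) (hu : ContDiff ℝ 2 u) (i : Fin N) :
    Continuous (pd2 i i u) :=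
  ((pd_contDiff u hu i).continuous_fderiv (by norm_num)).clm_apply continuous_const

lemma lap_cont {N : ℕ} (u : Pt N → ℝ) (hu : ContDiff ℝ 2 u) : Continuous (lap u) :=
  continuous_finsetSum _ fun i _ => pd2_cont u hu i

lemma fc_lap {N : ℕ} (k : Fin N → ℤ) (u : Pt N → ℝ) (hu : ContDiff ℝ 2 u) (hp : ZPeriodic u) :
    fc k (lap u) = ((-(4*π^2 * ∑ i, ((k i : ℝ))^2) : ℝ) : ℂ) * fc k u := by
  have h1 : ∀ i, fc k (pd2 i i u) = (cf k i)^2 * fc k u := by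
    intro i
    unfold pd2
    rw [fc_pd k _ (pd_contDiff u hu i) (pd_periodic u hp i),
      fc_pd k u (hu.of_le (by norm_num)) hp]
    ring
  have h2 : fc k (lap u) = ∑ i, fc k (pd2 i i u) := by
    unfold fc
    rw [← integral_finsetSum]
    · simp only [lap, Complex.ofReal_sum, Finset.mul_sum]
    · intro i _
      exact cube_int ((ek_cont k).mul (Complex.continuous_ofReal.comp (pd2_cont u hu i)))
  rw [h2]
  simp only [h1, ← Finset.sum_mul]
  congr 1
  push_cast
  rw [Finset.mul_sum, ← Finset.sum_neg_distrib]
  refine Finset.sum_congr rfl fun i _ => ?_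
  simp only [cf, neg_sq, mul_pow, Complex.I_sq]
  ring

lemma fc_comb {N : ℕ} (k : Fin N → ℤ) (α : ℝ) (u : Pt N → ℝ) (hu : ContDiff ℝ 2 u)
    (hp : ZPeriodic u) :
    fc k (fun x => α * u x + lap u x) = ((α - 4*π^2 * ∑ i, ((k i : ℝ))^2 : ℝ) : ℂ) * fc k u := by
  have h : fc k (fun x => α * u x + lap u x) = α * fc k u + fc k (lap u) := by
    unfold fc
    rw [← integral_const_mul, ← integral_add]
    · congr 1; ext x; push_cast; ring
    · exact cube_int (continuous_const.mul ((ek_cont k).mul (Complex.continuous_ofReal.comp hu.continuous)))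
    · exact cube_int ((ek_cont k).mul (Complex.continuous_ofReal.comp (lap_cont u hu)))
  rw [h, fc_lap k u hu hp]
  push_cast
  ring

lemma fc_zero {N : ℕ} (f : Pt N → ℝ) : fc 0 f = ((∫ x in cube N, f x : ℝ) : ℂ) := by
  unfold fc
  rw [← integral_complex_ofReal]
  congr 1; ext x
  simp [ek, Lk_apply, cf]

lemma taylor_lb (W : ℝ → ℝ) (hW : ContDiff ℝ 4 W) (w m : ℝ)
    (hW4 : ∀ t : ℝ, iteratedDeriv 4 W t ≥ w^2) (s : ℝ) :
    W m + iteratedDeriv 1 W m * s + iteratedDeriv 2 W m / 2 * s^2 + iteratedDeriv 3 W m / 6 * s^3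
      + w^2/24 * s^4 ≤ W (m + s) := by
  by_cases hs : s = 0
  · simp [hs]
  have hne : m ≠ m + s := by simpa using hs
  obtain ⟨t, ht, h⟩ := taylor_mean_remainder_lagrange_iteratedDeriv (n := 3) hne
    (hW.contDiffOn (s := Set.uIcc m (m+s)) |>.of_le (by norm_num))
  have hu := uniqueDiffOn_uIcc hne
  have hm : m ∈ Set.uIcc m (m+s) := Set.left_mem_uIcc
  have e : ∀ j : ℕ, j ≤ 4 → iteratedDerivWithin j W (Set.uIcc m (m+s)) m = iteratedDeriv j W m := by
    intro j hj
    exact iteratedDerivWithin_eq_iteratedDeriv hu ((hW.of_le (by exact_mod_cast hj)).contDiffAt) hm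
  simp only [taylor_within_apply, Finset.sum_range_succ, Finset.sum_range_zero] at h
  rw [e 0 (by norm_num), e 1 (by norm_num), e 2 (by norm_num), e 3 (by norm_num)] at h
  simp [Nat.factorial] at h
  have h4 := mul_le_mul_of_nonneg_right (hW4 t) (by positivity : 0 ≤ s^4)
  simp only [iteratedDeriv_one]
  linarith

section Parseval

attribute [local instance] instMeasureSpaceUnitAddCircle
  instIsProbabilityMeasureUnitAddCircleVolume

lemma cube_eq_Ioc (N : ℕ) {E : Type*} [NormedAddCommGroup E] [NormedSpace ℝ E] (g : Pt N → E) :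
    ∫ x in cube N, g x = ∫ x in {x : Pt N | ∀ i, x i ∈ Set.Ioc ((0 : Pt N) i) ((0 : Pt N) i + 1)}, g x := by
  have h : (Set.univ.pi fun i : Fin N => Set.Ioc ((0 : Pt N) i) ((1 : Pt N) i)) =ᵐ[volume]
      Set.Icc (0 : Pt N) 1 := Measure.univ_pi_Ioc_ae_eq_Icc
  unfold cube
  rw [← setIntegral_congr_set h]
  congr 2
  ext x
  simp [Set.mem_pi]

def liftT {N : ℕ} (y : UnitAddTorus (Fin N)) : Pt N :=
  fun i => (AddCircle.equivIoc (1:ℝ) 0 (y i) : ℝ)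

lemma liftT_meas {N : ℕ} : Measurable (liftT (N := N)) :=
  measurable_pi_lambda _ fun i =>
    measurable_subtype_coe.comp ((AddCircle.measurableEquivIoc (1:ℝ) 0).measurable.comp
      (measurable_pi_apply i))

lemma liftT_mem {N : ℕ} (y : UnitAddTorus (Fin N)) : liftT y ∈ cube N := by
  have h : ∀ i, liftT y i ∈ Set.Ioc (0:ℝ) (0+1) := fun i => (AddCircle.equivIoc (1:ℝ) 0 (y i)).2
  refine ⟨fun i => (h i).1.le, fun i => ?_⟩
  have := (h i).2
  simpa using this

lemma liftT_coe {N : ℕ} (x : Pt N)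
    (hx : x ∈ {x : Pt N | ∀ i, x i ∈ Set.Ioc ((0 : Pt N) i) ((0 : Pt N) i + 1)}) :
    liftT (fun i => (x i : UnitAddCircle)) = x := by
  ext i
  have := AddCircle.equivIoc_coe_of_mem (p := (1:ℝ)) (a := 0) (hx i)
  simp only [liftT]
  rw [this]

lemma Ioc_meas (N : ℕ) : MeasurableSet
    {x : Pt N | ∀ i, x i ∈ Set.Ioc ((0 : Pt N) i) ((0 : Pt N) i + 1)} :=
  MeasurableSet.univ_pi' (fun _ => measurableSet_Ioc)

lemma parseval {N : ℕ} (f : Pt N → ℝ) (hf : Continuous f) :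
    HasSum (fun k => ‖fc k f‖^2) (∫ x in cube N, (f x)^2) := by
  set F : UnitAddTorus (Fin N) → ℂ := fun y => (f (liftT y) : ℂ) with hF
  have hFm : Measurable F := Complex.measurable_ofReal.comp (hf.measurable.comp liftT_meas)
  obtain ⟨C, hC⟩ := (isCompact_Icc (a := (0 : Pt N)) (b := 1)).exists_bound_of_continuousOn
    hf.continuousOn
  have hL : MemLp F 2 volume := MemLp.of_bound hFm.aestronglyMeasurable C
    (Eventually.of_forall fun y => by
      simpa [hF] using hC _ (liftT_mem y))
  have h := UnitAddTorus.hasSum_sq_mFourierCoeff (hL.toLp F)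
  have hae := hL.coeFn_toLp
  have e1 : ∀ k, UnitAddTorus.mFourierCoeff (hL.toLp F) k = fc k f := by
    intro k
    have : UnitAddTorus.mFourierCoeff (hL.toLp F) k = UnitAddTorus.mFourierCoeff F k := by
      unfold UnitAddTorus.mFourierCoeff
      refine integral_congr_ae ?_
      filter_upwards [hae] with y hy
      rw [hy]
    rw [this, UnitAddTorus.mFourierCoeff_eq_integral F k (0 : Pt N), fc, cube_eq_Ioc]
    refine setIntegral_congr_fun (Ioc_meas N) fun x hx => ?_
    simp only [smul_eq_mul, ek_mFourier, hF]
    rw [liftT_coe x hx]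
  have e2 : ∫ t, ‖(hL.toLp F) t‖ ^ 2 = ∫ x in cube N, (f x)^2 := by
    have : ∫ t, ‖(hL.toLp F) t‖ ^ 2 = ∫ t, ‖F t‖^2 := by
      refine integral_congr_ae ?_
      filter_upwards [hae] with y hy
      rw [hy]
    rw [this, UnitAddTorus.integral_preimage (fun t => ‖F t‖^2) (0 : Pt N), cube_eq_Ioc]
    refine setIntegral_congr_fun (Ioc_meas N) fun x hx => ?_
    simp only [hF]
    rw [liftT_coe x hx]
    simp
  simp only [e1] at h
  rwa [e2] at h

end Parseval

/-- nonnegativity of the quadratic form -/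
lemma quad_nonneg {N : ℕ} (α c : ℝ) (u : Pt N → ℝ) (hu : ContDiff ℝ 2 u) (hp : ZPeriodic u)
    (hstab : 0 ≤ c + freqMinPFC N α) (h0 : ∫ x in cube N, u x = 0) :
    0 ≤ ∫ x in cube N, ((α * u x + lap u x)^2 + c * (u x)^2) := by
  have hc1 : Continuous (fun x => α * u x + lap u x) :=
    (continuous_const.mul hu.continuous).add (lap_cont u hu)
  have p1 := parseval _ hc1
  have hlc := lap_cont u hu
  have huc := hu.continuous
  have p2 := (parseval u hu.continuous).mul_left c
  rw [integral_add (cube_int (by fun_prop)) (cube_int (by fun_prop)),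
    integral_const_mul]
  refine (p1.add p2).nonneg fun k => ?_
  rw [fc_comb k α u hu hp, norm_mul, mul_pow, Complex.norm_real, norm_eq_abs, sq_abs, ← add_mul]
  by_cases hk : k = 0
  · subst hk
    rw [fc_zero, h0]
    simp
  · have : freqMinPFC N α ≤ (α - 4*π^2 * ∑ i, ((k i : ℝ))^2)^2 := by
      refine csInf_le ⟨0, ?_⟩ ⟨k, hk, rfl⟩
      rintro t ⟨k, -, rfl⟩
      positivity
    have h3 : 0 ≤ (α - 4*π^2 * ∑ i, ((k i : ℝ))^2)^2 + c := by linarith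
    positivity

lemma lap_integral {N : ℕ} (u : Pt N → ℝ) (hu : ContDiff ℝ 2 u) (hp : ZPeriodic u) :
    ∫ x in cube N, lap u x = 0 := by
  have h := fc_lap 0 u hu hp
  rw [fc_zero] at h
  simpa using h

lemma lap_smul {N : ℕ} (t : ℝ) (u : Pt N → ℝ) (x : Pt N) :
    lap (fun y => t * u y) x = t * lap u x := by
  have h1 : ∀ (i : Fin N) (v : Pt N → ℝ), pd i (fun y => t * v y) = fun y => t * pd i v y := by
    intro i v
    ext y
    unfold pd
    have := fderiv_const_smul_field (𝕜 := ℝ) (R := ℝ) t (f := v)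
    rw [show (fun y => t * v y) = t • v from rfl, this]
    simp
  simp only [lap, pd2, h1, Finset.mul_sum]

lemma surj3 : Function.Surjective (fun s : ℝ => s^3) := by
  refine (continuous_pow 3).surjective (tendsto_pow_atTop (by norm_num)) ?_
  have h : Tendsto (fun x : ℝ => -((-x)^3)) atBot atBot :=
    tendsto_neg_atTop_atBot.comp ((tendsto_pow_atTop (by norm_num)).comp tendsto_neg_atBot_atTop)
  refine h.congr fun x => ?_
  ring

lemma pn_bound {N : ℕ} (α c : ℝ) (u : Pt N → ℝ) (hu : ContDiff ℝ 2 u) (hp : ZPeriodic u)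
    (hstab : 0 ≤ c + freqMinPFC N α) (h0 : ∫ x in cube N, u x = 0)
    (hB : (∫ x in cube N, (u x)^3) ≠ 0) :
    PN N α c * (∫ x in cube N, (u x)^3)^2 ≤
      (∫ x in cube N, ((α * u x + lap u x)^2 + c * (u x)^2)) * (∫ x in cube N, (u x)^4) := by
  set B := ∫ x in cube N, (u x)^3 with hBd
  obtain ⟨t, ht⟩ : ∃ t : ℝ, t^3 * B = 1 := by
    have : ∃ s : ℝ, s^3 = B⁻¹ := by
      obtain ⟨s, hs⟩ := surj3 B⁻¹
      exact ⟨s, hs⟩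
    obtain ⟨s, hs⟩ := this
    exact ⟨s, by rw [hs, inv_mul_cancel₀ hB]⟩
  have hle : PN N α c ≤ Penergy α c (fun y => t * u y) := by
    refine csInf_le ⟨0, ?_⟩ ⟨_, ⟨contDiff_const.mul hu, fun x i => by simp only [hp x i], ?_, ?_⟩, rfl⟩
    · rintro p ⟨v, ⟨hv1, hv2, -, hv4⟩, rfl⟩
      exact mul_nonneg (quad_nonneg α c v hv1 hv2 hstab hv4)
        (integral_nonneg fun x => by positivity)
    · simp only [mul_pow, integral_const_mul]
      exact ht
    · simp only [integral_const_mul, h0, mul_zero]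
  have hE : Penergy α c (fun y => t * u y) = t^6 *
      ((∫ x in cube N, ((α * u x + lap u x)^2 + c * (u x)^2)) * (∫ x in cube N, (u x)^4)) := by
    unfold Penergy
    have e : ∀ x, (α * (t * u x) + lap (fun y => t * u y) x)^2 + c * (t * u x)^2
        = t^2 * ((α * u x + lap u x)^2 + c * (u x)^2) := by
      intro x; rw [lap_smul]; ring
    simp only [e, integral_const_mul]
    simp only [mul_pow, integral_const_mul]
    ring
  rw [hE] at hle
  have := mul_le_mul_of_nonneg_right hle (sq_nonneg B)
  refine this.trans (le_of_eq ?_)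
  have h6 : t^6 * B^2 = 1 := by
    calc t^6 * B^2 = (t^3*B)^2 := by ring
      _ = 1 := by rw [ht]; norm_num
  linear_combination h6 * ((∫ x in cube N, ((α * u x + lap u x)^2 + c * (u x)^2)) * (∫ x in cube N, (u x)^4))

lemma periodic_nat {N : ℕ} (u : Pt N → ℝ) (hp : ZPeriodic u) (x : Pt N) :
    ∃ y ∈ cube N, u y = u x := by
  have key : ∀ (i : Fin N) (n : ℤ) (x : Pt N), u (x + Pi.single i (n:ℝ)) = u x := by
    intro i n
    induction n using Int.induction_on with
    | zero => simp
    | succ n ih =>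
      intro x
      have h := hp (x + Pi.single i ((n:ℤ):ℝ)) i
      rw [add_assoc, ← Pi.single_add, ih x] at h
      rw [← h]
      simp
    | pred n ih =>
      intro x
      rw [← ih x, ← hp (x + Pi.single i _) i, add_assoc, ← Pi.single_add]
      simp
  have key2 : ∀ (s : Finset (Fin N)) (x : Pt N),
      u (x + ∑ i ∈ s, Pi.single i ((-⌊x i⌋ : ℤ) : ℝ)) = u x := by
    intro s x
    induction s using Finset.induction_on with
    | empty => simp
    | insert a s ha ih =>
      rw [Finset.sum_insert ha, add_comm (Pi.single a _), ← add_assoc, key, ih]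
  refine ⟨_, ?_, key2 Finset.univ x⟩
  have : x + ∑ i, Pi.single i ((-⌊x i⌋ : ℤ) : ℝ) = fun i => Int.fract (x i) := by
    rw [Finset.univ_sum_single (fun i => ((-⌊x i⌋ : ℤ) : ℝ))]
    ext i
    simp [Int.fract, sub_eq_add_neg]
  rw [this]
  exact ⟨fun i => Int.fract_nonneg _, fun i => (Int.fract_lt_one _).le⟩

lemma int_four_pos {N : ℕ} (u : Pt N → ℝ) (hu : Continuous u) (hp : ZPeriodic u) (hne : ∃ x, u x ≠ 0) :
    0 < ∫ x in cube N, (u x)^4 := by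
  obtain ⟨x, hx⟩ := hne
  obtain ⟨y, hy, hyx⟩ := periodic_nat u hp x
  have hc : Continuous fun x => (u x)^4 := hu.pow 4
  have hcl : y ∈ closure (interior (cube N)) := by
    have h1 : (interior (cube N)).Nonempty := by
      refine ⟨fun _ => 1/2, ?_⟩
      have : (Set.univ.pi fun _ : Fin N => Set.Ioo (0:ℝ) 1) ⊆ cube N :=
        fun z hz => ⟨fun i => (hz i trivial).1.le, fun i => (hz i trivial).2.le⟩
      refine interior_maximal this (isOpen_set_pi Set.finite_univ fun _ _ => isOpen_Ioo) ?_
      intro i _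
      norm_num
    have h2 : Convex ℝ (cube N) := convex_Icc 0 1
    rw [h2.closure_interior_eq_closure_of_nonempty_interior h1]
    exact subset_closure hy
  obtain ⟨z, hz, hzU⟩ := mem_closure_iff.1 hcl {z | u z ≠ 0} (isOpen_ne_fun hu continuous_const)
    (by simpa [hyx] using hx)
  rw [setIntegral_pos_iff_support_of_nonneg_ae (Eventually.of_forall fun x => by positivity)
    (cube_int hc)]
  refine lt_of_lt_of_le ?_ (measure_mono (s := {z | u z ≠ 0} ∩ interior (cube N)) ?_)
  · exact ((isOpen_ne_fun hu continuous_const).inter isOpen_interior).measure_pos _ ⟨z, hz, hzU⟩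
  · rintro a ⟨ha, ha'⟩
    exact ⟨by simpa using ha, interior_subset ha'⟩

lemma lap_shift {N : ℕ} (m : ℝ) (φ : Pt N → ℝ) (x : Pt N) :
    lap (fun y => φ y - m) x = lap φ x := by
  have h1 : ∀ (i : Fin N), pd i (fun y => φ y - m) = pd i φ := by
    intro i
    ext y
    unfold pd
    rw [fderiv_sub_const]
  simp only [lap, pd2, h1]

lemma cube_vol (N : ℕ) : volume.real (cube N) = 1 := by
  simp [cube, Measure.real, Real.volume_Icc_pi]

/-- the energy difference lower bound -/
lemma energy_diff {N : ℕ} (m α w : ℝ) (W : ℝ → ℝ) (hW : ContDiff ℝ 4 W)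
    (hW4 : ∀ t : ℝ, iteratedDeriv 4 W t ≥ w^2) (φ : Pt N → ℝ) (hφ : ContDiff ℝ 2 φ)
    (u : Pt N → ℝ) (hud : u = fun x => φ x - m) (hp : ZPeriodic u) (h0 : ∫ x in cube N, u x = 0) :
    Fen α W (fun _ : Pt N => m) +
      ((1/2) * (∫ x in cube N, ((α * u x + lap u x)^2 + iteratedDeriv 2 W m * (u x)^2))
        + iteratedDeriv 3 W m / 6 * (∫ x in cube N, (u x)^3)
        + w^2/24 * (∫ x in cube N, (u x)^4)) ≤ Fen α W φ := by
  have hu : ContDiff ℝ 2 u := by rw [hud]; exact hφ.sub contDiff_const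
  have hlc := lap_cont u hu
  have huc := hu.continuous
  have hl : ∀ x, lap φ x = lap u x := fun x => by rw [hud, lap_shift]
  have hφu : ∀ x, φ x = m + u x := fun x => by rw [hud]; ring
  have hm : Fen α W (fun _ : Pt N => m) = (1/2) * (α*m)^2 + W m := by
    have : ∀ x, lap (fun _ : Pt N => m) x = 0 := by
      intro x
      have := lap_smul 0 (fun _ : Pt N => m) x
      have h2 := lap_shift m (fun _ : Pt N => m) x
      simp only [sub_self] at h2
      simp only [zero_mul] at this
      rw [← h2, this]
    simp [Fen, this, cube_vol]
  have hlow : ∫ x in cube N, (((1/2) * (α*m)^2 + W m)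
      + ((α^2*m + iteratedDeriv 1 W m) * u x + (α * m * lap u x
      + ((1/2) * ((α * u x + lap u x)^2 + iteratedDeriv 2 W m * (u x)^2)
      + (iteratedDeriv 3 W m / 6 * (u x)^3 + w^2/24 * (u x)^4))))) ≤ Fen α W φ := by
    unfold Fen
    have hWc := hW.continuous
    have hφc := hφ.continuous
    have hlφ := lap_cont φ hφ
    refine setIntegral_mono (cube_int (by fun_prop)) (cube_int (by fun_prop)) fun x => ?_
    have := taylor_lb W hW w m hW4 (u x)
    simp only [hl, hφu]
    nlinarith
  refine le_trans (le_of_eq ?_) hlow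
  rw [hm]
  generalize (1/2) * (α*m)^2 + W m = K
  obtain ⟨q, hq⟩ : ∃ q : Pt N → ℝ,
      q = fun x => (α * u x + lap u x)^2 + iteratedDeriv 2 W m * (u x)^2 := ⟨_, rfl⟩
  have hqc : Continuous q := by rw [hq]; fun_prop
  have hqx : ∀ x, (α * u x + lap u x)^2 + iteratedDeriv 2 W m * (u x)^2 = q x := fun x => by rw [hq]
  simp only [hqx]
  rw [integral_add (cube_int (by fun_prop)) (cube_int (by fun_prop)),
    integral_add (cube_int (by fun_prop)) (cube_int (by fun_prop)),
    integral_add (cube_int (by fun_prop)) (cube_int (by fun_prop)),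
    integral_add (cube_int (by fun_prop)) (cube_int (by fun_prop)),
    integral_add (cube_int (by fun_prop)) (cube_int (by fun_prop))]
  simp only [integral_const_mul, h0, lap_integral u hu hp]
  simp [cube_vol]
  try ring

lemma real_ineq (A B C d w P : ℝ) (hw : 0 < w) (hA : 0 ≤ A) (hC : 0 ≤ C)
    (hP : d^2/(3*w^2) ≤ P) (h : P * B^2 ≤ A * C) : 0 ≤ (1/2)*A + d/6*B + w^2/24*C := by
  have h1 : d^2 * B^2 ≤ 3 * w^2 * (A*C) := by
    rw [div_le_iff₀ (by positivity)] at hP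
    nlinarith [mul_le_mul_of_nonneg_right hP (sq_nonneg B), mul_le_mul_of_nonneg_left h (by positivity : 0 ≤ 3*w^2)]
  have h2 : (d*B/6)^2 ≤ ((1/2)*A + w^2/24*C)^2 := by
    nlinarith [sq_nonneg ((1/2)*A - w^2/24*C)]
  have := (abs_le.1 (abs_le_of_sq_le_sq h2 (by positivity))).1
  linarith

lemma real_ineq_strict (A B C d w P : ℝ) (hw : 0 < w) (hA : 0 ≤ A) (hC : 0 ≤ C) (hB : B ≠ 0)
    (hP : d^2/(3*w^2) < P) (h : P * B^2 ≤ A * C) : 0 < (1/2)*A + d/6*B + w^2/24*C := by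
  have h1 : d^2 * B^2 < 3 * w^2 * (A*C) := by
    rw [div_lt_iff₀ (by positivity)] at hP
    have hB2 : 0 < B^2 := by positivity
    nlinarith [mul_lt_mul_of_pos_right hP hB2, mul_le_mul_of_nonneg_left h (by positivity : 0 ≤ 3*w^2)]
  have h2 : (d*B/6)^2 < ((1/2)*A + w^2/24*C)^2 := by
    nlinarith [sq_nonneg ((1/2)*A - w^2/24*C)]
  have := (abs_lt.1 (abs_lt_of_sq_lt_sq h2 (by positivity))).1
  linarith

/-- Theorem 3.2, part 2: global minimality (and uniqueness under strict inequality)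
of the uniform state m. -/
theorem uniform_state_global_min (N : ℕ) (hN : 0 < N) (m α w : ℝ) (W : ℝ → ℝ)
    (hw : 0 < w) (hW : ContDiff ℝ 4 W)
    (hW4 : ∀ t : ℝ, iteratedDeriv 4 W t ≥ w^2)
    (hstab : 0 ≤ iteratedDeriv 2 W m + freqMinPFC N α)
    (hP : PN N α (iteratedDeriv 2 W m) ≥ (iteratedDeriv 3 W m)^2 / (3 * w^2)) :
    (∀ φ : Pt N → ℝ, MemH2m m φ → Fen α W φ ≥ Fen α W (fun _ : Pt N => m)) ∧
      (PN N α (iteratedDeriv 2 W m) > (iteratedDeriv 3 W m)^2 / (3 * w^2) →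
        ∀ φ : Pt N → ℝ, MemH2m m φ → φ ≠ (fun _ : Pt N => m) →
          Fen α W φ > Fen α W (fun _ : Pt N => m)) := by
  have setup : ∀ φ : Pt N → ℝ, MemH2m m φ → ContDiff ℝ 2 (fun x => φ x - m) ∧
      ZPeriodic (fun x => φ x - m) ∧ ∫ x in cube N, (φ x - m) = 0 := by
    rintro φ ⟨h1, h2, h3⟩
    refine ⟨h1.sub contDiff_const, fun x i => by simp only [h2 x i], ?_⟩
    rw [integral_sub (cube_int h1.continuous) (cube_int continuous_const), h3]
    simp [cube_vol]
  constructor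
  · intro φ hφ
    obtain ⟨hu, hp, h0⟩ := setup φ hφ
    have hE := energy_diff m α w W hW hW4 φ hφ.1 _ rfl hp h0
    have hA := quad_nonneg α _ _ hu hp hstab h0
    have hC : 0 ≤ ∫ x in cube N, (φ x - m)^4 := integral_nonneg fun x => by positivity
    by_cases hB : (∫ x in cube N, (φ x - m)^3) = 0
    · rw [hB] at hE
      have : 0 ≤ w^2/24 * ∫ x in cube N, (φ x - m)^4 := by positivity
      linarith
    · have := real_ineq _ _ _ _ w _ hw hA hC hP (pn_bound α _ _ hu hp hstab h0 hB)
      linarith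
  · intro hP' φ hφ hne
    obtain ⟨hu, hp, h0⟩ := setup φ hφ
    have hE := energy_diff m α w W hW hW4 φ hφ.1 _ rfl hp h0
    have hA := quad_nonneg α _ _ hu hp hstab h0
    have hC : 0 < ∫ x in cube N, (φ x - m)^4 := by
      refine int_four_pos _ hu.continuous hp ?_
      by_contra! hcon
      exact hne (funext fun x => sub_eq_zero.1 (hcon x))
    by_cases hB : (∫ x in cube N, (φ x - m)^3) = 0
    · rw [hB] at hE
      have : 0 < w^2/24 * ∫ x in cube N, (φ x - m)^4 := by positivity
      linarith
    · have := real_ineq_strict _ _ _ _ w _ hw hA hC.le hB hP' (pn_bound α _ _ hu hp hstab h0 hB)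
      linarith

end
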